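/- arXiv:1306.3070 — 5 statements merged into one kernel-verified Lean document; each statement's English description precedes it below -/
import Mathlib

section
/- Fix n ∈ ℕ₀ and λ ∈ ℝ with 0 < |λ| ≤ 1. Then the coupled Hamiltonian h_λ has no eigenvalues: there is no nonzero f ∈ ℓ²(ℤ) and e ∈ ℝ with h_λ f = e f. -/
open Complex

open Filter Topology

/-- A real convex sequence on `ℤ` vanishing at both ends is zero. -/
lemma eq_zero_of_convex_of_tendsto_zero {u : ℤ → ℝ}
    (hconv : ∀ x, 2 * u x ≤ u (x + 1) + u (x - 1))
    (htop : Tendsto u atTop (𝓝 0)) (hbot : Tendsto u atBot (𝓝 0)) (x : ℤ) : u x = 0 := by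
  have hmono : Monotone fun x => u (x + 1) - u x := monotone_int_of_le_succ fun x => by
    have h := hconv (x + 1)
    rw [add_sub_cancel_right] at h
    linarith
  have hdtop : Tendsto (fun x => u (x + 1) - u x) atTop (𝓝 0) := by
    simpa using (htop.comp (tendsto_atTop_add_const_right _ (1 : ℤ) tendsto_id)).sub htop
  have hdbot : Tendsto (fun x => u (x + 1) - u x) atBot (𝓝 0) := by
    simpa using (hbot.comp (tendsto_atBot_add_const_right _ (1 : ℤ) tendsto_id)).sub hbot
  have hstep (y : ℤ) : u (y + 1) = u y :=
    sub_eq_zero.1 (le_antisymm (hmono.ge_of_tendsto hdtop y) (hmono.le_of_tendsto hdbot y))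
  have hu : Monotone u := monotone_int_of_le_succ fun y => (hstep y).ge
  exact le_antisymm (hu.ge_of_tendsto htop x) (hu.le_of_tendsto hbot x)

/-- A solution of the free recurrence on a right half-line which vanishes at infinity is zero there,
provided `|e| < 1`. -/
lemma eq_zero_of_free_recurrence {u : ℤ → ℝ} {e : ℝ} {N : ℤ} (he : |e| < 1)
    (hrec : ∀ x, N < x → u (x + 1) + u (x - 1) = 2 * e * u x)
    (htop : Tendsto u atTop (𝓝 0)) {x : ℤ} (hx : N ≤ x) : u x = 0 := by
  set Q : ℤ → ℝ := fun x => u (x + 1) ^ 2 + u x ^ 2 - 2 * e * (u x * u (x + 1)) with hQ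
  have hconst : ∀ y, x ≤ y → Q y = Q x := by
    refine Int.leInduction rfl fun y hy ih => ?_
    rw [← ih]
    have h := hrec (y + 1) (by lia)
    rw [add_sub_cancel_right] at h
    simp only [hQ]
    linear_combination (u (y + 1 + 1) - u y) * h
  have hs := htop.comp (tendsto_atTop_add_const_right _ (1 : ℤ) tendsto_id)
  have hlim : Tendsto Q atTop (𝓝 0) := by
    simpa using ((hs.pow 2).add (htop.pow 2)).sub ((htop.mul hs).const_mul (2 * e))
  have hQx : Q x = 0 := tendsto_nhds_unique
    (tendsto_const_nhds.congr' ((eventually_ge_atTop x).mono fun y hy => (hconst y hy).symm)) hlim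
  have hsq : (1 - e ^ 2) * u x ^ 2 ≤ 0 := by
    simp only [hQ] at hQx
    nlinarith [sq_nonneg (u (x + 1) - e * u x)]
  have he2 : e ^ 2 < 1 := (sq_lt_one_iff_abs_lt_one e).2 he
  by_contra hne
  have := mul_pos (sub_pos.2 he2) (pow_pos (abs_pos.2 hne) 2)
  rw [sq_abs] at this
  linarith

/-- A Jacobi operator on `ℤ` with zero diagonal and nonzero off-diagonal entries in `[-1, 1]`, which
is free near `+∞`, has no nonzero real formal eigenvector vanishing at `±∞`. -/
lemma eq_zero_of_jacobi_recurrence {a u : ℤ → ℝ} {e : ℝ} {N : ℤ} (ha0 : ∀ x, a x ≠ 0)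
    (ha1 : ∀ x, |a x| ≤ 1) (haN : ∀ x, N ≤ x → a x = 1)
    (hrec : ∀ x, a x * u (x + 1) + a (x - 1) * u (x - 1) = 2 * e * u x)
    (htop : Tendsto u atTop (𝓝 0)) (hbot : Tendsto u atBot (𝓝 0)) (x : ℤ) : u x = 0 := by
  rcases le_or_gt 1 |e| with he | he
  · refine abs_eq_zero.1 (eq_zero_of_convex_of_tendsto_zero (u := fun x => |u x|) (fun x => ?_)
      (by simpa using htop.abs) (by simpa using hbot.abs) x)
    have hbound (y z : ℤ) : |a y * u z| ≤ |u z| := by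
      rw [abs_mul]
      exact mul_le_of_le_one_left (abs_nonneg _) (ha1 y)
    calc 2 * |u x| ≤ 2 * |e| * |u x| := by nlinarith [abs_nonneg (u x)]
      _ = |a x * u (x + 1) + a (x - 1) * u (x - 1)| := by
        rw [hrec, abs_mul, abs_mul, abs_two]
      _ ≤ |u (x + 1)| + |u (x - 1)| :=
        (abs_add_le _ _).trans (add_le_add (hbound _ _) (hbound _ _))
  · have hright (y : ℤ) (hy : N ≤ y) : u y = 0 :=
      eq_zero_of_free_recurrence he (fun z hz => by
        simpa [haN z hz.le, haN (z - 1) (by lia)] using hrec z) htop hy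
    have hleft : ∀ y, y ≤ N → u y = 0 ∧ u (y + 1) = 0 := by
      refine Int.leInductionDown ⟨hright N le_rfl, hright _ (by lia)⟩ fun y _ ih => ?_
      have h := hrec y
      rw [ih.1, ih.2, mul_zero, mul_zero, zero_add] at h
      exact ⟨(mul_eq_zero.1 h).resolve_left (ha0 _), by rw [sub_add_cancel]; exact ih.1⟩
    rcases le_total N x with hx | hx
    exacts [hright x hx, (hleft x hx).1]

/-- Square-summable sequences vanish at infinity. -/
lemma tendsto_cofinite_zero_of_lp_two {ι : Type*} (f : lp (fun _ : ι => ℂ) 2) :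
    Tendsto (fun x => f x) cofinite (𝓝 0) := by
  have hsum : Summable fun x => ‖f x‖ ^ 2 := by
    simpa using (lp.memℓp f).summable (by norm_num)
  rw [tendsto_zero_iff_norm_tendsto_zero]
  simpa using hsum.tendsto_cofinite_zero.sqrt

/-- For `0 < |λ| ≤ 1`, the coupled Hamiltonian `h_λ = h + (λ-1)v` on `ℓ²(ℤ)` has no
eigenvalues. -/
theorem stmt_3 (n : ℕ) (l : ℝ) (hl0 : 0 < |l|) (hl1 : |l| ≤ 1)
    (hlam : lp (fun _ : ℤ => ℂ) 2 →L[ℂ] lp (fun _ : ℤ => ℂ) 2)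
    (hform : ∀ (f : lp (fun _ : ℤ => ℂ) 2) (x : ℤ),
      hlam f x = (f (x + 1) + f (x - 1)) / 2
        + ((l : ℂ) - 1) / 2 *
          ((if x = -(n : ℤ) - 1 then f (-(n : ℤ)) else 0)
            + (if x = -(n : ℤ) then f (-(n : ℤ) - 1) else 0)
            + (if x = (n : ℤ) + 1 then f (n : ℤ) else 0)
            + (if x = (n : ℤ) then f ((n : ℤ) + 1) else 0))) :
    ¬ ∃ (f : lp (fun _ : ℤ => ℂ) 2) (e : ℝ), f ≠ 0 ∧ hlam f = (e : ℂ) • f := by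
  rintro ⟨f, e, hf, heig⟩
  obtain ⟨a, ha⟩ : ∃ a : ℤ → ℝ, ∀ x, a x = if x = n ∨ x = -(n : ℤ) - 1 then l else 1 :=
    ⟨_, fun _ => rfl⟩
  have hmul (x : ℤ) (z : ℂ) : (a x : ℂ) * z
      = z + (l - 1) * ((if x = (n : ℤ) then z else 0)
        + (if x = -(n : ℤ) - 1 then z else 0)) := by
    rw [ha]
    by_cases h1 : x = (n : ℤ)
    · rw [if_pos (.inl h1), if_pos h1, if_neg (by lia)]
      ring
    · by_cases h2 : x = -(n : ℤ) - 1
      · rw [if_pos (.inr h2), if_neg h1, if_pos h2]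
        ring
      · rw [if_neg (not_or.2 ⟨h1, h2⟩), if_neg h1, if_neg h2]
        push_cast
        ring
  have hrec (x : ℤ) : (a x : ℂ) * f (x + 1) + a (x - 1) * f (x - 1) = (2 * e : ℝ) * f x := by
    have h := hform f x
    rw [heig, lp.coeFn_smul, Pi.smul_apply, smul_eq_mul] at h
    push_cast
    rw [mul_assoc, h, hmul, hmul]
    have h1 : (if x = (n : ℤ) then f ((n : ℤ) + 1) else 0)
        = if x = (n : ℤ) then f (x + 1) else 0 := by split_ifs with hx <;> simp [hx]
    have h2 : (if x = -(n : ℤ) - 1 then f (-(n : ℤ)) else 0)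
        = if x = -(n : ℤ) - 1 then f (x + 1) else 0 := by split_ifs with hx <;> simp [hx]
    have h3 : (if x = (n : ℤ) + 1 then f (n : ℤ) else 0)
        = if x = (n : ℤ) + 1 then f (x - 1) else 0 := by split_ifs with hx <;> simp [hx]
    have h4 : (if x = -(n : ℤ) then f (-(n : ℤ) - 1) else 0)
        = if x = -(n : ℤ) then f (x - 1) else 0 := by split_ifs with hx <;> simp [hx]
    have h5 : x - 1 = (n : ℤ) ↔ x = (n : ℤ) + 1 := by lia
    have h6 : x - 1 = -(n : ℤ) - 1 ↔ x = -(n : ℤ) := by lia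
    simp only [h1, h2, h3, h4, h5, h6]
    ring
  have ha0 (x : ℤ) : a x ≠ 0 := by
    rw [ha]
    split_ifs
    exacts [abs_pos.1 hl0, one_ne_zero]
  have ha1 (x : ℤ) : |a x| ≤ 1 := by
    rw [ha]
    split_ifs
    exacts [hl1, abs_one.le]
  have haN (x : ℤ) (hx : (n : ℤ) + 1 ≤ x) : a x = 1 := by
    rw [ha, if_neg (by lia)]
  have hlim := tendsto_cofinite_zero_of_lp_two f
  rw [Int.cofinite_eq, tendsto_sup] at hlim
  refine hf (lp.ext (funext fun x => Complex.ext ?_ ?_))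
  · exact eq_zero_of_jacobi_recurrence (u := fun y => (f y).re) ha0 ha1 haN
      (fun y => by simpa [-ofReal_mul, re_ofReal_mul] using congrArg re (hrec y))
      ((continuous_re.tendsto 0).comp hlim.2) ((continuous_re.tendsto 0).comp hlim.1) x
  · exact eq_zero_of_jacobi_recurrence (u := fun y => (f y).im) ha0 ha1 haN
      (fun y => by simpa [-ofReal_mul, im_ofReal_mul] using congrArg im (hrec y))
      ((continuous_im.tendsto 0).comp hlim.2) ((continuous_im.tendsto 0).comp hlim.1) x
end

section
/- Fix n ∈ ℕ₀, λ ∈ ℝ, e ∈ (-1,1), and set E := e + i·√(1-e²). Let Σ be the 4×4 complex block matrix Σ = [[A, B],[σ₁Bσ₁, A]], where A := (1-E²)^{-1}·[[1-λE², (1-λ)E],[(1-λ)E, 1-λE²]], B := (1-λ)·E^{2n+1}·(1-E²)^{-1}·[[1, E],[E, E²]], and σ₁ = [[0,1],[1,0]]. Then det Σ = Δ_λ(e), where Δ_λ(e) := (1-E²)^{-2}·[(1-E^{4n+4}) - 2λ²E²(1-E^{4n+2}) + λ⁴E⁴(1-E^{4n})], and moreover Δ_λ(e) = (1-E²)^{-2}·[(1-λ²E²)²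 - (1-λ²)²·E^{4n+4}]. -/
open Complex Matrix

/-- Determinant of a block matrix with `2 × 2` blocks, transported to `Fin 4`. -/
theorem det_fromBlocks_fin_two {R : Type*} [CommRing R]
    (A B C D : Matrix (Fin 2) (Fin 2) R) :
    (Matrix.fromBlocks A B C D).det =
      (!![A 0 0, A 0 1, B 0 0, B 0 1;
          A 1 0, A 1 1, B 1 0, B 1 1;
          C 0 0, C 0 1, D 0 0, D 0 1;
          C 1 0, C 1 1, D 1 0, D 1 1] : Matrix (Fin 4) (Fin 4) R).det := by
  rw [← Matrix.det_submatrix_equiv_self (finSumFinEquiv (m := 2) (n := 2))]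
  congr 1
  ext i j
  rcases i with i | i <;> rcases j with j | j <;> fin_cases i <;> fin_cases j <;> rfl

/-- A point `e + i√(1-e²)` of the unit circle with `e ∈ (-1, 1)` does not square to `1`. -/
theorem one_sub_sq_ne_zero_of_mem_Ioo {e : ℝ} (he : e ∈ Set.Ioo (-1 : ℝ) 1) :
    1 - ((e : ℂ) + Complex.I * (Real.sqrt (1 - e ^ 2) : ℂ)) ^ 2 ≠ 0 := by
  have hpos : 0 < 1 - e ^ 2 := by nlinarith [he.1, he.2]
  have hs := Real.sq_sqrt hpos.le
  intro h
  have hre := congrArg Complex.re h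
  simp [pow_two] at hre
  nlinarith

/-- The determinant of the boundary interaction matrix `Σ_λ(e - i0)`:
`det Σ = (1-E²)^{-2}[(1-E^{4n+4}) - 2λ²E²(1-E^{4n+2}) + λ⁴E⁴(1-E^{4n})]
       = (1-E²)^{-2}[(1-λ²E²)² - (1-λ²)²E^{4n+4}]`, where `E = e + i√(1-e²)`. -/
theorem stmt_9 (n : ℕ) (l : ℝ) (e : ℝ) (he : e ∈ Set.Ioo (-1 : ℝ) 1) :
    let E : ℂ := (e : ℂ) + Complex.I * (Real.sqrt (1 - e ^ 2) : ℂ)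
    let A : Matrix (Fin 2) (Fin 2) ℂ :=
      (1 - E ^ 2)⁻¹ • !![1 - (l : ℂ) * E ^ 2, (1 - (l : ℂ)) * E;
                         (1 - (l : ℂ)) * E, 1 - (l : ℂ) * E ^ 2]
    let B : Matrix (Fin 2) (Fin 2) ℂ :=
      ((1 - (l : ℂ)) * E ^ (2 * n + 1) * (1 - E ^ 2)⁻¹) • !![1, E; E, E ^ 2]
    let s1 : Matrix (Fin 2) (Fin 2) ℂ := !![0, 1; 1, 0]
    let S : Matrix (Fin 2 ⊕ Fin 2) (Fin 2 ⊕ Fin 2) ℂ := Matrix.fromBlocks A B (s1 * B * s1) A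
    S.det = ((1 - E ^ 2) ^ 2)⁻¹ *
        ((1 - E ^ (4 * n + 4)) - 2 * (l : ℂ) ^ 2 * E ^ 2 * (1 - E ^ (4 * n + 2))
          + (l : ℂ) ^ 4 * E ^ 4 * (1 - E ^ (4 * n))) ∧
    ((1 - E ^ 2) ^ 2)⁻¹ *
        ((1 - E ^ (4 * n + 4)) - 2 * (l : ℂ) ^ 2 * E ^ 2 * (1 - E ^ (4 * n + 2))
          + (l : ℂ) ^ 4 * E ^ 4 * (1 - E ^ (4 * n)))
      = ((1 - E ^ 2) ^ 2)⁻¹ *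
        ((1 - (l : ℂ) ^ 2 * E ^ 2) ^ 2 - (1 - (l : ℂ) ^ 2) ^ 2 * E ^ (4 * n + 4)) := by
  intro E A B s1 S
  have hE : 1 - E ^ 2 ≠ 0 := one_sub_sq_ne_zero_of_mem_Ioo he
  clear_value E
  refine ⟨?_, by ring⟩
  have hS : S.det = _ := det_fromBlocks_fin_two A B (s1 * B * s1) A
  rw [hS, Matrix.det_succ_row_zero]
  simp [A, B, s1, Fin.sum_univ_succ, Matrix.det_fin_three, Matrix.mul_apply, Fin.succAbove,
    Matrix.submatrix_apply]
  field_simp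
  ring
end

section
/- Fix inverse temperatures 0 < β_L ≤ β_R < ∞ and set δ := (β_R - β_L)/2 and β := (β_R + β_L)/2. For n ∈ ℕ₀ set n_S := 2n+1 and Ep(n) := (2δ/(n_S+1))·Σ_{i=1}^{n_S} S₀(cos(iπ/(n_S+1))), where S₀(e) := e·(1-e²)^{3/2}·(ϱ_{β_L}(e) - ϱ_{β_R}(e)). Then lim_{n→∞} Ep(n) = δ·∫_{-π}^{π} (dk/2π)·cos(k)·|sin k|³·sinh(δ·cos k)/(cosh²((β/2)·cos k) + sinh²((δ/2)·cos k)). -/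
open Real Filter MeasureTheory

/-- Left Riemann sums of a continuous function over `[0, L]` converge to its integral. -/
theorem tendsto_left_riemann_sum {f : ℝ → ℝ} {L : ℝ} (hL : 0 < L)
    (hf : ContinuousOn f (Set.Icc 0 L)) :
    Tendsto (fun N : ℕ => L / N * ∑ i ∈ Finset.range N, f (i * L / N)) atTop
      (nhds (∫ x in (0 : ℝ)..L, f x)) := by
  rw [Metric.tendsto_atTop]
  intro ε hε
  have huc := isCompact_Icc.uniformContinuousOn_of_continuous hf
  rw [Metric.uniformContinuousOn_iff] at huc
  obtain ⟨η, hη, huc⟩ := huc (ε / (2 * L)) (by positivity)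
  obtain ⟨N₀, hN₀⟩ := exists_nat_gt (L / η)
  refine ⟨N₀ + 1, fun N hN => ?_⟩
  have hN' : (N₀ : ℝ) + 1 ≤ N := by exact_mod_cast hN
  have hNpos : (0 : ℝ) < N := by linarith [N₀.cast_nonneg (α := ℝ)]
  have hmesh : L / N < η := by
    rw [div_lt_iff₀ hη] at hN₀
    rw [div_lt_iff₀ hNpos]
    nlinarith
  set a : ℕ → ℝ := fun i => i * L / N with ha
  have hstep (i : ℕ) : a (i + 1) - a i = L / N := by
    simp only [ha]; push_cast; ring
  have hsub (i : ℕ) (hi : i < N) : Set.Icc (a i) (a (i + 1)) ⊆ Set.Icc 0 L := by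
    have hi' : (i : ℝ) + 1 ≤ N := by exact_mod_cast hi
    refine Set.Icc_subset_Icc (by simp only [ha]; positivity) ?_
    simp only [ha]
    rw [div_le_iff₀ hNpos]
    push_cast
    nlinarith
  have hmono (i : ℕ) : a i ≤ a (i + 1) := by
    have := hstep i
    have : 0 < L / N := by positivity
    linarith
  have hint (i : ℕ) (hi : i < N) : IntervalIntegrable f volume (a i) (a (i + 1)) :=
    (hf.mono (by rw [Set.uIcc_of_le (hmono i)]; exact hsub i hi)).intervalIntegrable
  have hsum := intervalIntegral.sum_integral_adjacent_intervals hint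
  have ha0 : a 0 = 0 := by simp [ha]
  have haN : a N = L := by simp only [ha]; field_simp
  rw [ha0, haN] at hsum
  rw [Real.dist_eq, ← hsum, Finset.mul_sum, ← Finset.sum_sub_distrib]
  have hterm : ∀ i ∈ Finset.range N,
      |L / N * f (a i) - ∫ x in (a i)..(a (i + 1)), f x| ≤ ε / (2 * L) * (L / N) := by
    intro i hi
    have hi := Finset.mem_range.mp hi
    have hconst : L / N * f (a i) = ∫ _ in (a i)..(a (i + 1)), f (a i) := by
      rw [intervalIntegral.integral_const, hstep, smul_eq_mul]
    rw [hconst, ← intervalIntegral.integral_sub intervalIntegrable_const (hint i hi)]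
    have hbd := intervalIntegral.norm_integral_le_of_norm_le_const
      (a := a i) (b := a (i + 1)) (f := fun x => f (a i) - f x) (C := ε / (2 * L)) (by
        intro x hx
        rw [Set.uIoc_of_le (hmono i)] at hx
        have := huc (a i) (hsub i hi ⟨le_rfl, hmono i⟩) x (hsub i hi ⟨hx.1.le, hx.2⟩) (by
          have := hstep i
          rw [Real.dist_eq, abs_sub_comm, abs_of_pos (by linarith [hx.1])]
          linarith [hx.2])
        rw [Real.dist_eq] at this
        exact this.le)
    rwa [hstep, abs_of_pos (by positivity : 0 < L / N)] at hbd
  calc _ ≤ _ := Finset.abs_sum_le_sum_abs _ _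
    _ ≤ _ := Finset.sum_le_sum hterm
    _ = ε / 2 := by
      rw [Finset.sum_const, Finset.card_range, nsmul_eq_mul]
      field_simp
    _ < ε := by linarith

/-- The difference of two Planck densities in terms of hyperbolic functions. -/
theorem planck_density_sub (p q : ℝ) :
    (1 + Real.exp p)⁻¹ - (1 + Real.exp q)⁻¹ =
      Real.sinh ((q - p) / 2) /
        (Real.cosh ((p + q) / 4) ^ 2 + Real.sinh ((q - p) / 4) ^ 2) / 2 := by
  have hpos : 0 < Real.cosh ((p + q) / 4) ^ 2 + Real.sinh ((q - p) / 4) ^ 2 := by positivity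
  have e1 : Real.exp p = (Real.exp (p / 4)) ^ 4 := by
    rw [← Real.exp_nat_mul]; congr 1; push_cast; ring
  have e2 : Real.exp q = (Real.exp (q / 4)) ^ 4 := by
    rw [← Real.exp_nat_mul]; congr 1; push_cast; ring
  have e3 : Real.exp ((q - p) / 2) = Real.exp (q / 4) ^ 2 / Real.exp (p / 4) ^ 2 := by
    rw [← Real.exp_nat_mul, ← Real.exp_nat_mul, ← Real.exp_sub]; congr 1; push_cast; ring
  have e4 : Real.exp ((p + q) / 4) = Real.exp (p / 4) * Real.exp (q / 4) := by
    rw [← Real.exp_add]; congr 1; ring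
  have e5 : Real.exp ((q - p) / 4) = Real.exp (q / 4) / Real.exp (p / 4) := by
    rw [← Real.exp_sub]; congr 1; ring
  rw [div_div, eq_div_iff (by positivity)]
  simp only [Real.sinh_eq, Real.cosh_eq, Real.exp_neg, e1, e2, e3, e4, e5]
  have hx := Real.exp_pos (p / 4)
  have hy := Real.exp_pos (q / 4)
  generalize Real.exp (p / 4) = x at *
  generalize Real.exp (q / 4) = y at *
  field_simp
  ring

/-- The integral of an even function over `[-a, a]` is twice that over `[0, a]`. -/
theorem integral_neg_self_of_even {f : ℝ → ℝ} (hf : Continuous f) (heven : ∀ x, f (-x) = f x)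
    (a : ℝ) : ∫ x in (-a)..a, f x = 2 * ∫ x in (0 : ℝ)..a, f x := by
  rw [← intervalIntegral.integral_add_adjacent_intervals (b := 0)
    (hf.intervalIntegrable _ _) (hf.intervalIntegrable _ _)]
  have h := intervalIntegral.integral_comp_neg (a := 0) (b := a) f
  simp only [heven, neg_zero] at h
  rw [← h]
  ring

/-- Large sample limit of the second order entropy production:
`lim_{n→∞} Ep(n) = δ ∫_{-π}^{π} (dk/2π) cos k |sin k|³ sinh(δ cos k) /
(cosh²((β/2)cos k) + sinh²((δ/2)cos k))`. -/
theorem stmt_14 (βL βR : ℝ) (h0 : 0 < βL) (hle : βL ≤ βR) :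
    let δ : ℝ := (βR - βL) / 2
    let β : ℝ := (βR + βL) / 2
    let ϱ : ℝ → ℝ → ℝ := fun b e => (1 + Real.exp (b * e))⁻¹
    let S0 : ℝ → ℝ := fun e => e * (1 - e ^ 2) ^ ((3 : ℝ) / 2) * (ϱ βL e - ϱ βR e)
    let Ep : ℕ → ℝ := fun n => (2 * δ / (2 * n + 1 + 1)) *
      ∑ i ∈ Finset.Icc 1 (2 * n + 1), S0 (Real.cos (i * π / (2 * n + 1 + 1)))
    Tendsto Ep atTop (nhds (δ *
      ((∫ k in (-π)..π, Real.cos k * |Real.sin k| ^ 3 * Real.sinh (δ * Real.cos k) /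
        (Real.cosh (β / 2 * Real.cos k) ^ 2 + Real.sinh (δ / 2 * Real.cos k) ^ 2)) /
      (2 * π)))) := by
  intro δ β ϱ S0 Ep
  set F : ℝ → ℝ := fun k => Real.cos k * |Real.sin k| ^ 3 * Real.sinh (δ * Real.cos k) /
    (Real.cosh (β / 2 * Real.cos k) ^ 2 + Real.sinh (δ / 2 * Real.cos k) ^ 2) with hF
  have hcont : Continuous F := by
    refine Continuous.div (by fun_prop) (by fun_prop) fun k => ?_
    positivity
  have heven (k : ℝ) : F (-k) = F k := by simp [hF]
  have hS0 (k : ℝ) : S0 (Real.cos k) = F k / 2 := by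
    have hpow : (1 - Real.cos k ^ 2) ^ ((3 : ℝ) / 2) = |Real.sin k| ^ 3 := by
      rw [← Real.sin_sq, ← sq_abs, ← Real.rpow_natCast_mul (abs_nonneg _), ← Real.rpow_natCast]
      norm_num
    have hδ : (βR * Real.cos k - βL * Real.cos k) / 2 = δ * Real.cos k := by
      simp only [δ]; ring
    have hβ : (βL * Real.cos k + βR * Real.cos k) / 4 = β / 2 * Real.cos k := by
      simp only [β]; ring
    have hδ' : (βR * Real.cos k - βL * Real.cos k) / 4 = δ / 2 * Real.cos k := by
      simp only [δ]; ring
    simp only [S0, ϱ, hF]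
    rw [hpow, planck_density_sub, hδ, hβ, hδ']
    ring
  have hlim := ((tendsto_left_riemann_sum Real.pi_pos hcont.continuousOn).comp
    (tendsto_atTop_mono (fun n : ℕ => (by lia : n ≤ 2 * n + 1 + 1)) tendsto_id)).const_mul (δ / π)
  rw [integral_neg_self_of_even hcont heven]
  convert hlim using 1
  · funext n
    have hF0 : F 0 = 0 := by simp [hF]
    simp only [Ep, Function.comp_apply, hS0]
    rw [Finset.sum_range_succ', ← Finset.sum_div, Finset.range_eq_Ico,
      Finset.sum_Ico_add' (fun i : ℕ => F (i * π / ((2 * n + 1 + 1 : ℕ) : ℝ)))]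
    simp only [Nat.cast_zero, zero_mul, zero_div, hF0, add_zero, zero_add]
    rw [Finset.Ico_add_one_right_eq_Icc]
    push_cast
    generalize ∑ i ∈ Finset.Icc 1 (2 * n + 1), F (i * π / (2 * n + 1 + 1)) = s
    field_simp
  · congr 1
    field_simp
end

section
/- Fix β ∈ ℝ and let ψ^β(t) := (2/π)·∫_{-1}^{1} (1-e²)^{1/2}·(1+e^{βe})^{-1}·e^{ite} de. For every ε ∈ ℝ the Laplace transform Ψ^β(iε) := ∫_0^∞ ψ^β(t)·e^{-iεt} dt converges absolutely, and its real part satisfies Re[Ψ^β(iε)] = 2·(1-ε²)^{1/2}·(1+e^{βε})^{-1} if |ε| < 1, and Re[Ψ^β(iε)] = 0 if |ε| ≥ 1. -/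
open Complex Real MeasureTheory

open scoped FourierTransform ComplexConjugate

theorem hasDerivAt_div_sqrt_one_sub_sq {x : ℝ} (hx : x ∈ Set.Ioo (-1 : ℝ) 1) :
    HasDerivAt (fun y : ℝ => y / √(1 - y ^ 2)) (1 / √(1 - x ^ 2) ^ 3) x := by
  have h0 : 0 < 1 - x ^ 2 := by nlinarith [hx.1, hx.2]
  have hs : 0 < √(1 - x ^ 2) := Real.sqrt_pos.2 h0
  have h := (hasDerivAt_id x).div ((((hasDerivAt_id x).pow 2).const_sub 1).sqrt h0.ne') hs.ne'
  convert! h using 1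
  have h2 : √(1 - x ^ 2) ^ 2 = 1 - x ^ 2 := Real.sq_sqrt h0.le
  simp only [id, Pi.pow_apply]
  field_simp
  simp only [h2]
  ring

/-- A function on `[-1, 1]` whose derivatives of order `k ≤ 2` are bounded by a multiple of
`(1 - x²)^(1/2 - k)` has a Fourier transform decaying like `t^(-3/2)`. -/
theorem norm_integral_mul_cexp_le {f f' f'' : ℝ → ℝ} {C : ℝ}
    (hfc : ContinuousOn f (Set.Icc (-1) 1))
    (hf : ∀ x ∈ Set.Ioo (-1 : ℝ) 1, HasDerivAt f (f' x) x)
    (hf' : ∀ x ∈ Set.Ioo (-1 : ℝ) 1, HasDerivAt f' (f'' x) x)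
    (hf''c : ContinuousOn f'' (Set.Ioo (-1) 1))
    (b0 : ∀ x ∈ Set.Icc (-1 : ℝ) 1, |f x| ≤ C * √(1 - x ^ 2))
    (b1 : ∀ x ∈ Set.Ioo (-1 : ℝ) 1, |f' x| ≤ C * (1 / √(1 - x ^ 2)))
    (b2 : ∀ x ∈ Set.Ioo (-1 : ℝ) 1, |f'' x| ≤ C * (1 / √(1 - x ^ 2) ^ 3))
    {t : ℝ} (ht : 1 < t) :
    ‖∫ x in (-1 : ℝ)..1, (f x : ℂ) * cexp (I * t * x)‖ ≤ 8 * C * t ^ (-3 / 2 : ℝ) := by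
  have hC : 0 ≤ C := by simpa using (abs_nonneg _).trans (b0 0 (by simp))
  have ht0 : 0 < t := by linarith
  obtain ⟨s, hs0, hs1, hst, hs3⟩ : ∃ s : ℝ, 0 < s ∧ s < 1 ∧ t * s ^ 2 = 1 ∧
      t ^ (-3 / 2 : ℝ) = s ^ 3 := by
    refine ⟨t ^ (-1 / 2 : ℝ), by positivity,
      Real.rpow_lt_one_of_one_lt_of_neg ht (by norm_num), ?_, ?_⟩
    · rw [← Real.rpow_natCast, ← Real.rpow_mul ht0.le]
      norm_num [Real.rpow_neg_one, ht0.ne']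
    · rw [← Real.rpow_natCast, ← Real.rpow_mul ht0.le]
      norm_num
  obtain ⟨a, ha0, ha1, has⟩ : ∃ a : ℝ, 0 < a ∧ a < 1 ∧ 1 - a ^ 2 = s ^ 2 := by
    have h : 0 < 1 - s ^ 2 := by nlinarith
    refine ⟨√(1 - s ^ 2), Real.sqrt_pos.2 h, ?_, ?_⟩
    · rw [Real.sqrt_lt' one_pos]; nlinarith
    · rw [Real.sq_sqrt h.le]; ring
  have hsa : √(1 - a ^ 2) = s := by rw [has, Real.sqrt_sq hs0.le]
  have hsa' : √(1 - (-a) ^ 2) = s := by rw [neg_sq, hsa]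
  have hama : a ∈ Set.Ioo (-1 : ℝ) 1 := ⟨by linarith, ha1⟩
  have hamn : -a ∈ Set.Ioo (-1 : ℝ) 1 := ⟨by linarith, by linarith⟩
  have hsub : Set.uIcc (-a) a ⊆ Set.Ioo (-1) 1 := by
    rw [Set.uIcc_of_le (by linarith)]
    exact fun x hx => ⟨by linarith [hx.1], by linarith [hx.2]⟩
  have hE : ∀ x : ℝ, ‖cexp (I * t * x)‖ = 1 := fun x => by
    rw [show I * t * x = ((t * x : ℝ) : ℂ) * I by push_cast; ring]
    exact Complex.norm_exp_ofReal_mul_I _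
  have hEc : Continuous fun x : ℝ => cexp (I * t * x) := by fun_prop
  set φ : ℝ → ℂ := fun x => (f x : ℂ) * cexp (I * t * x) with hφ
  have hφn : ∀ x, ‖φ x‖ = |f x| := fun x => by simp [hφ, hE]
  have hφc : ContinuousOn φ (Set.Icc (-1) 1) :=
    (Complex.continuous_ofReal.comp_continuousOn hfc).mul hEc.continuousOn
  have hint : ∀ u ∈ Set.Icc (-1 : ℝ) 1, ∀ v ∈ Set.Icc (-1 : ℝ) 1,
      IntervalIntegrable φ volume u v := fun u hu v hv =>
    (hφc.mono (Set.uIcc_subset_Icc hu hv)).intervalIntegrable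
  have hm1 : (-1 : ℝ) ∈ Set.Icc (-1 : ℝ) 1 := by simp
  have hp1 : (1 : ℝ) ∈ Set.Icc (-1 : ℝ) 1 := by simp
  have hai := Set.Ioo_subset_Icc_self hama
  have hani := Set.Ioo_subset_Icc_self hamn
  have hsplit : ∫ x in (-1 : ℝ)..1, φ x =
      (∫ x in (-1 : ℝ)..(-a), φ x) + (∫ x in (-a)..a, φ x) + ∫ x in a..1, φ x := by
    rw [intervalIntegral.integral_add_adjacent_intervals (hint _ hm1 _ hani) (hint _ hani _ hai),
      intervalIntegral.integral_add_adjacent_intervals (hint _ hm1 _ hai) (hint _ hai _ hp1)]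
  have h1a : 1 - a ≤ s ^ 2 := by nlinarith
  have htail : ∀ x ∈ Set.Icc (-1 : ℝ) 1, a ^ 2 ≤ x ^ 2 → ‖φ x‖ ≤ C * s := fun x hx hax => by
    rw [hφn, ← hsa]
    exact (b0 x hx).trans (by gcongr)
  have hleft : ‖∫ x in (-1 : ℝ)..(-a), φ x‖ ≤ C * s ^ 3 := by
    have := intervalIntegral.norm_integral_le_of_norm_le_const (a := -1) (b := -a) (f := φ)
      (C := C * s) (fun x hx => by
        rw [Set.uIoc_of_le (by linarith)] at hx
        exact htail x ⟨hx.1.le, by linarith [hx.2]⟩ (by nlinarith [hx.2]))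
    refine this.trans ?_
    rw [show -a - -1 = 1 - a by ring, abs_of_nonneg (by linarith),
      show C * s ^ 3 = C * s * s ^ 2 by ring]
    gcongr
  have hright : ‖∫ x in a..1, φ x‖ ≤ C * s ^ 3 := by
    have := intervalIntegral.norm_integral_le_of_norm_le_const (a := a) (b := 1) (f := φ)
      (C := C * s) (fun x hx => by
        rw [Set.uIoc_of_le (by linarith)] at hx
        exact htail x ⟨by linarith [hx.1], hx.2⟩ (by nlinarith [hx.1]))
    refine this.trans ?_
    rw [abs_of_nonneg (by linarith), show C * s ^ 3 = C * s * s ^ 2 by ring]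
    gcongr
  -- two integrations by parts on `[-a, a]`
  set F : ℝ → ℂ := fun x => cexp (I * t * x) * (-I * s ^ 2 * f x + s ^ 4 * f' x) with hF
  set r : ℝ → ℂ := fun x => s ^ 4 * (f'' x * cexp (I * t * x)) with hr
  have hrn : ∀ x, ‖r x‖ = s ^ 4 * |f'' x| := fun x => by
    simp [hr, hE, abs_of_pos hs0]
  have hrc : ContinuousOn r (Set.uIcc (-a) a) :=
    continuousOn_const.mul ((Complex.continuous_ofReal.comp_continuousOn (hf''c.mono hsub)).mul
      hEc.continuousOn)
  have hFd : ∀ x ∈ Set.uIcc (-a) a, HasDerivAt F (φ x + r x) x := fun x hx => by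
    have he : HasDerivAt (fun y : ℝ => cexp (I * t * y)) (cexp (I * t * x) * (I * t)) x := by
      simpa using (((hasDerivAt_id x).ofReal_comp).const_mul (I * t)).cexp
    have h := he.mul (((hf x (hsub hx)).ofReal_comp.const_mul (-I * (s : ℂ) ^ 2)).add
      ((hf' x (hsub hx)).ofReal_comp.const_mul ((s : ℂ) ^ 4)))
    have hst' : (t : ℂ) * (s : ℂ) ^ 2 = 1 := by exact_mod_cast hst
    convert! h using 1
    simp only [hφ, hr, Pi.add_apply]
    linear_combination (-(f x : ℂ) - I * (s : ℂ) ^ 2 * f' x) * cexp (I * t * x) * hst' +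
      ((f x : ℂ) * cexp (I * t * x) * t * s ^ 2) * Complex.I_sq
  have hφi := hint _ hani _ hai
  have hri : IntervalIntegrable r volume (-a) a := hrc.intervalIntegrable
  have hparts : ∫ x in (-a)..a, φ x = F a - F (-a) - ∫ x in (-a)..a, r x := by
    rw [← intervalIntegral.integral_eq_sub_of_hasDerivAt hFd (hφi.add hri),
      intervalIntegral.integral_add hφi hri]
    ring
  have hFn : ∀ x ∈ Set.Ioo (-1 : ℝ) 1, √(1 - x ^ 2) = s → ‖F x‖ ≤ 2 * C * s ^ 3 :=
    fun x hx hxs => by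
    have h0 := b0 x (Set.Ioo_subset_Icc_self hx)
    have h1 := b1 x hx
    rw [hxs] at h0 h1
    rw [hF, norm_mul, hE, one_mul]
    refine (norm_add_le _ _).trans ?_
    simp only [norm_mul, norm_neg, norm_I, norm_pow, Complex.norm_real, Real.norm_eq_abs, one_mul,
      abs_of_pos hs0]
    calc s ^ 2 * |f x| + s ^ 4 * |f' x| ≤ s ^ 2 * (C * s) + s ^ 4 * (C * (1 / s)) := by gcongr
      _ = 2 * C * s ^ 3 := by field_simp; ring
  have hrint : ‖∫ x in (-a)..a, r x‖ ≤ 2 * C * s ^ 3 := by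
    have hG : ∀ x ∈ Set.uIcc (-a) a, HasDerivAt (fun y : ℝ => s ^ 4 * C * (y / √(1 - y ^ 2)))
        (s ^ 4 * C * (1 / √(1 - x ^ 2) ^ 3)) x := fun x hx =>
      (hasDerivAt_div_sqrt_one_sub_sq (hsub hx)).const_mul _
    have hGi : IntervalIntegrable (fun x : ℝ => s ^ 4 * C * (1 / √(1 - x ^ 2) ^ 3))
        volume (-a) a := by
      refine ContinuousOn.intervalIntegrable fun x hx => ?_
      have : √(1 - x ^ 2) ^ 3 ≠ 0 := by
        have := hsub hx
        have : 0 < 1 - x ^ 2 := by nlinarith [this.1, this.2]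
        positivity
      exact ContinuousAt.continuousWithinAt (by fun_prop (disch := assumption))
    refine (intervalIntegral.norm_integral_le_of_norm_le (by linarith)
      (ae_of_all _ fun x hx => ?_) hGi).trans ?_
    · rw [hrn, mul_assoc]
      have hx' := hsub (Set.uIoc_subset_uIcc (by rwa [Set.uIoc_of_le (by linarith)]))
      gcongr
      exact b2 x hx'
    · rw [intervalIntegral.integral_eq_sub_of_hasDerivAt hG hGi, hsa, hsa']
      calc s ^ 4 * C * (a / s) - s ^ 4 * C * (-a / s) = 2 * C * s ^ 3 * a := by field_simp; ring
        _ ≤ 2 * C * s ^ 3 := mul_le_of_le_one_right (by positivity) ha1.le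
  rw [hsplit, hparts, hs3]
  have hmid : ‖F a - F (-a) - ∫ x in (-a)..a, r x‖ ≤ 6 * C * s ^ 3 := by
    refine (norm_sub_le _ _).trans ?_
    linarith [norm_sub_le (F a) (F (-a)), hFn a hama hsa, hFn (-a) hamn hsa']
  refine (norm_add₃_le).trans ?_
  linarith

theorem exists_norm_integral_sqrt_mul_cexp_le {g : ℝ → ℝ} (hg : ContDiff ℝ 2 g) :
    ∃ C, ∀ t : ℝ, 1 < t →
      ‖∫ x in (-1 : ℝ)..1, ((√(1 - x ^ 2) * g x : ℝ) : ℂ) * cexp (I * t * x)‖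
        ≤ C * t ^ (-3 / 2 : ℝ) := by
  have hg1 : ContDiff ℝ 1 (deriv g) := hg.deriv'
  have hg2 : Continuous (deriv (deriv g)) := hg1.continuous_deriv le_rfl
  have hd1 : ∀ x, HasDerivAt g (deriv g x) x := fun x =>
    (hg.differentiable (by norm_num) x).hasDerivAt
  have hd2 : ∀ x, HasDerivAt (deriv g) (deriv (deriv g) x) x := fun x =>
    (hg1.differentiable (by norm_num) x).hasDerivAt
  obtain ⟨K0, hK0⟩ := (isCompact_Icc (a := (-1 : ℝ)) (b := 1)).exists_bound_of_continuousOn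
    hg.continuous.continuousOn
  obtain ⟨K1, hK1⟩ := (isCompact_Icc (a := (-1 : ℝ)) (b := 1)).exists_bound_of_continuousOn
    hg1.continuous.continuousOn
  obtain ⟨K2, hK2⟩ := (isCompact_Icc (a := (-1 : ℝ)) (b := 1)).exists_bound_of_continuousOn
    hg2.continuousOn
  simp only [Real.norm_eq_abs] at hK0 hK1 hK2
  have p0 : 0 ≤ K0 := (abs_nonneg _).trans (hK0 0 (by simp))
  have p1 : 0 ≤ K1 := (abs_nonneg _).trans (hK1 0 (by simp))
  have p2 : 0 ≤ K2 := (abs_nonneg _).trans (hK2 0 (by simp))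
  have hpos : ∀ x ∈ Set.Ioo (-1 : ℝ) 1, 0 < 1 - x ^ 2 := fun x hx => by nlinarith [hx.1, hx.2]
  have hw : ∀ x ∈ Set.Ioo (-1 : ℝ) 1, HasDerivAt (fun y : ℝ => √(1 - y ^ 2))
      (-(x / √(1 - x ^ 2))) x := fun x hx => by
    convert! (((hasDerivAt_id x).pow 2).const_sub 1).sqrt (hpos x hx).ne' using 1
    simp only [id, Pi.pow_apply]
    field_simp
    simp [mul_comm]
  have hle1 : ∀ x : ℝ, √(1 - x ^ 2) ≤ 1 := fun x =>
    Real.sqrt_le_one.2 (by nlinarith [sq_nonneg x])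
  refine ⟨8 * (K0 + 2 * K1 + K2), fun t ht => norm_integral_mul_cexp_le
    (f' := fun x => -(x / √(1 - x ^ 2)) * g x + √(1 - x ^ 2) * deriv g x)
    (f'' := fun x => (-(1 / √(1 - x ^ 2) ^ 3) * g x + -(x / √(1 - x ^ 2)) * deriv g x) +
      (-(x / √(1 - x ^ 2)) * deriv g x + √(1 - x ^ 2) * deriv (deriv g) x))
    ?_ ?_ ?_ ?_ ?_ ?_ ?_ ht⟩
  · have := hg.continuous
    fun_prop
  · exact fun x hx => (hw x hx).mul (hd1 x)
  · exact fun x hx => ((hasDerivAt_div_sqrt_one_sub_sq hx).neg.mul (hd1 x)).add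
      ((hw x hx).mul (hd2 x))
  · intro x hx
    have h1 : √(1 - x ^ 2) ≠ 0 := (Real.sqrt_pos.2 (hpos x hx)).ne'
    have h2 : √(1 - x ^ 2) ^ 3 ≠ 0 := pow_ne_zero _ h1
    have := hg.continuous
    have := hg1.continuous
    exact ContinuousAt.continuousWithinAt (by fun_prop (disch := assumption))
  · intro x hx
    rw [abs_mul, abs_of_nonneg (Real.sqrt_nonneg _), mul_comm]
    have := hK0 x hx
    gcongr
    linarith
  · intro x hx
    have hx' := Set.Ioo_subset_Icc_self hx
    have hs := Real.sqrt_pos.2 (hpos x hx)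
    have hl := hle1 x
    set w := √(1 - x ^ 2)
    have hxa : |x| ≤ 1 := abs_le.2 hx'
    have hinv : w ≤ 1 / w := hl.trans (by rw [le_div_iff₀ hs]; simpa using hl)
    refine (abs_add_le _ _).trans ?_
    simp only [abs_mul, abs_neg, abs_div, abs_of_pos hs]
    calc |x| / w * |g x| + w * |deriv g x| ≤ 1 / w * K0 + 1 / w * K1 := by
          gcongr
          exacts [hK0 x hx', hK1 x hx']
      _ = (K0 + K1) * (1 / w) := by ring
      _ ≤ (K0 + 2 * K1 + K2) * (1 / w) := by
          gcongr ?_ * _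
          linarith
  · intro x hx
    have hx' := Set.Ioo_subset_Icc_self hx
    have hs := Real.sqrt_pos.2 (hpos x hx)
    have hl := hle1 x
    set w := √(1 - x ^ 2)
    have hxa : |x| ≤ 1 := abs_le.2 hx'
    have hw3 : 1 / w ≤ 1 / w ^ 3 := by
      gcongr
      exact pow_le_of_le_one hs.le hl (by norm_num)
    have hinv : w ≤ 1 / w ^ 3 :=
      (hl.trans (by rw [le_div_iff₀ hs]; simpa using hl)).trans hw3
    have hxw : |x| / w ≤ 1 / w ^ 3 := (by gcongr : |x| / w ≤ 1 / w).trans hw3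
    refine (abs_add_le _ _).trans ((add_le_add (abs_add_le _ _) (abs_add_le _ _)).trans ?_)
    simp only [abs_mul, abs_neg, abs_div, abs_pow, abs_one, abs_of_pos hs]
    calc 1 / w ^ 3 * |g x| + |x| / w * |deriv g x| +
          (|x| / w * |deriv g x| + w * |deriv (deriv g) x|)
        ≤ 1 / w ^ 3 * K0 + 1 / w ^ 3 * K1 + (1 / w ^ 3 * K1 + 1 / w ^ 3 * K2) := by
          gcongr
          exacts [hK0 x hx', hK1 x hx', hK1 x hx', hK2 x hx']
      _ = (K0 + 2 * K1 + K2) * (1 / w ^ 3) := by ring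

/-- A function `ψ` with `ψ (-t) = conj (ψ t)` satisfies `∫ ψ = 2 Re ∫_{t > 0} ψ`. -/
theorem integral_eq_two_mul_re_of_neg_eq_conj {ψ : ℝ → ℂ} (hψ : Integrable ψ)
    (hneg : ∀ t, ψ (-t) = conj (ψ t)) :
    ∫ t, ψ t = ((2 * (∫ t in Set.Ioi (0 : ℝ), ψ t).re : ℝ) : ℂ) := by
  rw [← intervalIntegral.integral_Iic_add_Ioi hψ.integrableOn (hψ.integrableOn (s := Set.Ioi 0)),
    ← neg_zero, ← integral_comp_neg_Ioi, neg_zero]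
  simp_rw [hneg]
  rw [integral_conj, add_comm, Complex.add_conj]

/-- Fourier inversion for an integrable real function `f`, phrased for the one-sided integral of
its characteristic function `t ↦ ∫ f x e^{itx} dx`. -/
theorem re_integral_Ioi_charFun_mul_cexp {f : ℝ → ℝ} (hf : Integrable f) (hfc : Continuous f)
    (hψ : Integrable fun t : ℝ => ∫ x, (f x : ℂ) * cexp (I * t * x)) (ε : ℝ) :
    (∫ t in Set.Ioi (0 : ℝ), (∫ x, (f x : ℂ) * cexp (I * t * x)) * cexp (-(I * ε * t))).re
      = π * f ε := by
  set ψ : ℝ → ℂ := fun t => ∫ x, (f x : ℂ) * cexp (I * t * x) with hψdef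
  have hF : 𝓕 (fun x => (f x : ℂ)) = fun w => ψ (-(2 * π) * w) := by
    ext w
    rw [fourier_real_eq_integral_exp_smul]
    refine integral_congr_ae (ae_of_all _ fun x => ?_)
    simp only [smul_eq_mul]
    rw [mul_comm]
    congr 2
    push_cast
    ring
  have hpi : -(2 * π) ≠ 0 := by simp [pi_ne_zero]
  have hinv := hf.ofReal (𝕜 := ℂ) |>.fourierInv_fourier_eq
    (by erw [hF]; exact hψ.comp_mul_left' hpi) (v := ε)
    (Complex.continuous_ofReal.comp hfc).continuousAt
  have hval : ∫ t, ψ t * cexp (-(I * ε * t)) = ((2 * π * f ε : ℝ) : ℂ) := by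
    have h := Measure.integral_comp_mul_left (fun t : ℝ => ψ t * cexp (-(I * ε * t))) (-(2 * π))
    have h' : ∫ w : ℝ, (fun t : ℝ => ψ t * cexp (-(I * ε * t))) (-(2 * π) * w) = f ε := by
      refine Eq.trans ?_ hinv
      rw [fourierInv_eq']
      refine integral_congr_ae (ae_of_all _ fun x => ?_)
      erw [hF]
      simp only [smul_eq_mul]
      rw [mul_comm]
      congr 2
      simp
      ring
    rw [h', abs_inv, abs_neg, abs_of_pos (by positivity)] at h
    rw [Complex.ofReal_mul, h, Complex.real_smul, ← mul_assoc, ← Complex.ofReal_mul,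
      mul_inv_cancel₀ (by positivity), Complex.ofReal_one, one_mul]
  have hint : Integrable fun t : ℝ => ψ t * cexp (-(I * ε * t)) := by
    refine hψ.mul_bdd (c := 1) (by fun_prop) (ae_of_all _ fun t => ?_)
    rw [show -(I * ε * t) = ((-(ε * t) : ℝ) : ℂ) * I by push_cast; ring,
      Complex.norm_exp_ofReal_mul_I]
  have hneg : ∀ t : ℝ, ψ (-t) * cexp (-(I * ε * (-t : ℝ))) = conj (ψ t * cexp (-(I * ε * t))) := by
    intro t
    simp only [hψdef, map_mul, ← integral_conj, ← Complex.exp_conj, map_neg, Complex.conj_ofReal,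
      Complex.conj_I, Complex.ofReal_neg, mul_neg, neg_mul]
  have h2 := integral_eq_two_mul_re_of_neg_eq_conj hint hneg
  rw [hval] at h2
  have h3 : 2 * π * f ε = _ := Complex.ofReal_injective h2
  linarith

theorem integrable_charFun_of_norm_le {f : ℝ → ℝ} (hf : Integrable f) {C : ℝ}
    (hC : ∀ t : ℝ, 1 < t → ‖∫ x, (f x : ℂ) * cexp (I * t * x)‖ ≤ C * t ^ (-3 / 2 : ℝ)) :
    Integrable fun t : ℝ => ∫ x, (f x : ℂ) * cexp (I * t * x) := by
  have hcont : Continuous fun t : ℝ => ∫ x, (f x : ℂ) * cexp (I * t * x) := by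
    refine continuous_of_dominated (bound := fun x => ‖f x‖) (fun t => ?_)
      (fun t => ae_of_all _ fun x => ?_) hf.norm (ae_of_all _ fun x => by fun_prop)
    · exact hf.ofReal.aestronglyMeasurable.mul (by fun_prop)
    · rw [show I * t * x = ((t * x : ℝ) : ℂ) * I by push_cast; ring, norm_mul,
        Complex.norm_exp_ofReal_mul_I, mul_one, Complex.norm_real]
  refine hcont.locallyIntegrable.integrable_of_isBigO_atTop_of_norm_isNegInvariant
    (g := fun t : ℝ => t ^ (-3 / 2 : ℝ)) (ae_of_all _ fun t => ?_)
    (Asymptotics.IsBigO.of_bound C ?_) (integrableAtFilter_rpow_atTop_iff.2 (by norm_num))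
  · simp only [Function.comp_apply]
    rw [← Complex.norm_conj]
    simp only [map_mul, ← integral_conj, ← Complex.exp_conj, Complex.conj_ofReal,
      Complex.conj_I, Complex.ofReal_neg, mul_neg, neg_mul]
  · filter_upwards [Filter.eventually_gt_atTop 1] with t ht
    rw [Real.norm_of_nonneg (by positivity)]
    exact hC t ht

/-- The Laplace transform `Ψ^β(iε) = ∫_0^∞ ψ^β(t) e^{-iεt} dt` of the reservoir time
correlation function converges absolutely and
`Re[Ψ^β(iε)] = 2√(1-ε²)(1+e^{βε})⁻¹` for `|ε| < 1` and `= 0` for `|ε| ≥ 1`. -/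
theorem stmt_17 (β : ℝ) :
    let ψ : ℝ → ℂ := fun t => ((2 / π : ℝ) : ℂ) * ∫ e in (-1 : ℝ)..1,
      ((Real.sqrt (1 - e ^ 2) * (1 + Real.exp (β * e))⁻¹ : ℝ) : ℂ) *
        Complex.exp (Complex.I * t * e)
    (∀ ε : ℝ, IntegrableOn
      (fun t : ℝ => ψ t * Complex.exp (-(Complex.I * ε * t))) (Set.Ioi 0) volume) ∧
    (∀ ε : ℝ,
      (∫ t in Set.Ioi (0 : ℝ), ψ t * Complex.exp (-(Complex.I * ε * t))).re
        = if |ε| < 1 then 2 * Real.sqrt (1 - ε ^ 2) * (1 + Real.exp (β * ε))⁻¹ else 0) := by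
  intro ψ
  have hden : ∀ x : ℝ, 1 + Real.exp (β * x) ≠ 0 := fun x => by positivity
  set f : ℝ → ℝ := fun x => √(1 - x ^ 2) * (1 + Real.exp (β * x))⁻¹ with hf
  have hzero : ∀ x : ℝ, 1 ≤ |x| → f x = 0 := fun x hx => by
    have : 1 - x ^ 2 ≤ 0 := by nlinarith [sq_abs x]
    simp [hf, Real.sqrt_eq_zero_of_nonpos this]
  have hfc : Continuous f := by fun_prop (disch := exact hden _)
  have hfi : Integrable f := hfc.integrable_of_hasCompactSupport <|
    HasCompactSupport.intro (isCompact_Icc (a := (-1 : ℝ)) (b := 1)) fun x hx =>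
      hzero x (le_of_lt (by rwa [← not_le, abs_le]))
  have hψ : ∀ t, ψ t = ((2 / π : ℝ) : ℂ) * ∫ x, (f x : ℂ) * cexp (I * t * x) := fun t => by
    simp only [ψ]
    rw [intervalIntegral.integral_of_le (by norm_num),
      setIntegral_eq_integral_of_forall_compl_eq_zero]
    intro x hx
    have hx' : 1 ≤ |x| := by
      by_contra! h
      exact hx ⟨(abs_lt.1 h).1, (abs_lt.1 h).2.le⟩
    change (f x : ℂ) * _ = 0
    rw [hzero x hx', Complex.ofReal_zero, zero_mul]
  have hg : ContDiff ℝ 2 fun x : ℝ => (1 + Real.exp (β * x))⁻¹ :=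
    ContDiff.inv (by fun_prop) hden
  obtain ⟨C, hC⟩ := exists_norm_integral_sqrt_mul_cexp_le hg
  have hint : Integrable fun t : ℝ => ∫ x, (f x : ℂ) * cexp (I * t * x) := by
    refine integrable_charFun_of_norm_le hfi (C := C) fun t ht => ?_
    have h2 : ((2 / π : ℝ) : ℂ) ≠ 0 := by exact_mod_cast (by positivity : 2 / π ≠ 0)
    rw [← mul_left_cancel₀ h2 (hψ t)]
    exact hC t ht
  have hassoc : ∀ ε t : ℝ, ψ t * cexp (-(I * ε * t)) = ((2 / π : ℝ) : ℂ) *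
      ((∫ x, (f x : ℂ) * cexp (I * t * x)) * cexp (-(I * ε * t))) := fun ε t => by
    rw [hψ, mul_assoc]
  simp_rw [hassoc]
  refine ⟨fun ε => Integrable.integrableOn (Integrable.const_mul ?_ _), fun ε => ?_⟩
  · refine hint.mul_bdd (c := 1) (by fun_prop) (ae_of_all _ fun t => ?_)
    rw [show -(I * ε * t) = ((-(ε * t) : ℝ) : ℂ) * I by push_cast; ring,
      Complex.norm_exp_ofReal_mul_I]
  · have h := re_integral_Ioi_charFun_mul_cexp hfi hfc hint ε
    rw [integral_const_mul, Complex.re_ofReal_mul, h, div_mul_eq_mul_div, mul_div_assoc,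
      mul_div_cancel_left₀ _ pi_ne_zero]
    split_ifs with hε
    · rw [hf, mul_assoc]
    · rw [hzero ε (not_lt.1 hε), mul_zero]
end

section
/- Fix n ∈ ℕ with n ≥ 1, set n_S := 2n+1, let h_S be the n_S × n_S symmetric matrix with (h_S)_{ij} = ½ if |i-j| = 1 and 0 otherwise, fix inverse temperatures 0 < β_L < β_R < ∞, set δ := (β_R - β_L)/2, and let S₀(e) := e·(1-e²)^{3/2}·(ϱ_{β_L}(e) - ϱ_{β_R}(e)). Then the van Hove entropy production Ep_S := (2δ/(n_S+1))·tr[S₀(h_S)], where S₀(h_S) is defined via the continuous functional calculus of the Hermitian matrix h_S, satisfies Ep_S = (2δ/(n_S+1))·Σ_{i=1}^{n_S} S₀(cos(iπ/(n_S+1))) and Ep_S > 0. -/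
open Real

/-- If `A` is Hermitian and `μ` lists `card ι` distinct eigenvalues of `A`, then the trace of
`f(A)` is the sum of `f` over `μ`. -/
lemma Matrix.IsHermitian.trace_cfc_eq_sum_of_injective {ι : Type*} [Fintype ι] [DecidableEq ι]
    {A : Matrix ι ι ℝ} (hA : A.IsHermitian) (f : ℝ → ℝ) (μ : ι → ℝ)
    (hμ : Function.Injective μ) (v : ι → ι → ℝ) (hv : ∀ k, v k ≠ 0)
    (hAv : ∀ k, A.mulVec (v k) = μ k • v k) :
    (cfc f A).trace = ∑ k, f (μ k) := by
  have htr : (cfc f A).trace = ∑ k, f (hA.eigenvalues k) := by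
    rw [hA.cfc_eq, Matrix.IsHermitian.cfc, Unitary.conjStarAlgAut_apply, Matrix.trace_mul_comm,
      ← mul_assoc]
    simp [Matrix.trace]
  have hroots : A.charpoly.roots = Finset.univ.val.map hA.eigenvalues := by
    simpa using hA.roots_charpoly_eq_eigenvalues
  have hsub : Finset.univ.val.map μ ≤ Finset.univ.val.map hA.eigenvalues := by
    rw [Multiset.le_iff_subset (Finset.univ.nodup.map hμ)]
    intro x hx
    obtain ⟨k, -, rfl⟩ := Multiset.mem_map.1 hx
    rw [← hroots, Polynomial.mem_roots A.charpoly_monic.ne_zero,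
      ← Matrix.charpoly_toLin', ← Module.End.hasEigenvalue_iff_isRoot_charpoly]
    exact Module.End.hasEigenvalue_of_hasEigenvector (x := v k)
      ⟨Module.End.mem_eigenspace_iff.2 (by simpa using hAv k), hv k⟩
  have heq := Multiset.eq_of_le_of_card_le hsub (by simp)
  have hmap := congrArg (fun s => (s.map f).sum) heq
  simp only [Multiset.map_map] at hmap
  rw [htr]
  exact hmap.symm

/-- The discrete Laplacian acts on a sequence with Dirichlet boundary values by averaging
neighbours. -/
lemma sum_neighbours_eq_average (N : ℕ) (g : ℕ → ℝ) (hg0 : g 0 = 0) (hgN : g (N + 1) = 0)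
    (i : Fin N) :
    ∑ j : Fin N, (if ((i : ℤ) - (j : ℤ) = 1 ∨ (j : ℤ) - (i : ℤ) = 1) then (1 / 2 : ℝ) else 0)
      * g (j + 1) = (g i + g (i + 2)) / 2 := by
  obtain ⟨i, hi⟩ := i
  have hsplit : ∀ j : ℕ,
      (if ((i : ℤ) - (j : ℤ) = 1 ∨ (j : ℤ) - (i : ℤ) = 1) then (1 / 2 : ℝ) else 0) * g (j + 1)
        = (if j + 1 = i then g (j + 1) / 2 else 0)
          + (if j = i + 1 then g (j + 1) / 2 else 0) := by
    intro j
    split_ifs <;> first | omega | ring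
  rw [Fin.sum_univ_eq_sum_range
    (fun j => (if ((i : ℤ) - (j : ℤ) = 1 ∨ (j : ℤ) - (i : ℤ) = 1) then (1 / 2 : ℝ) else 0)
      * g (j + 1)) N, Finset.sum_congr rfl (fun j _ => hsplit j), Finset.sum_add_distrib, add_div]
  congr 1
  · cases i with
    | zero => simp [hg0]
    | succ m =>
      have hm : m < N := by omega
      simp [hm]
  · rw [Finset.sum_ite_eq']
    split_ifs with h
    · rfl
    · have : i + 2 = N + 1 := by simp at h; omega
      simp [this, hgN]

lemma sub_inv_one_add_exp_mul_pos {βL βR e : ℝ} (hlt : βL < βR) (he : e ≠ 0) :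
    0 < e * ((1 + Real.exp (βL * e))⁻¹ - (1 + Real.exp (βR * e))⁻¹) := by
  rcases he.lt_or_gt with he | he
  · refine mul_pos_of_neg_of_neg he (sub_neg.2 ?_)
    have := mul_lt_mul_of_neg_right hlt he
    gcongr (1 + Real.exp ?_)⁻¹
  · refine mul_pos he (sub_pos.2 ?_)
    gcongr

/-- Van Hove second law of thermodynamics: for `n ≥ 1`, the van Hove entropy production
`Ep_S = (2δ/(n_S+1))·tr[S₀(h_S)]`, with `S₀(h_S)` defined via the continuous functional
calculus of the Hermitian matrix `h_S`, equals
`(2δ/(n_S+1))·Σ_{i=1}^{n_S} S₀(cos(iπ/(n_S+1)))` and is strictly positive. -/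
theorem stmt_19 (n : ℕ) (hn : 1 ≤ n) (βL βR : ℝ) (h0 : 0 < βL) (hlt : βL < βR)
    (hS : Matrix (Fin (2 * n + 1)) (Fin (2 * n + 1)) ℝ)
    (hdef : ∀ i j : Fin (2 * n + 1),
      hS i j = if ((i : ℤ) - (j : ℤ) = 1 ∨ (j : ℤ) - (i : ℤ) = 1) then 1/2 else 0)
    (hH : hS.IsHermitian) :
    let nS : ℕ := 2 * n + 1
    let δ : ℝ := (βR - βL) / 2
    let ϱ : ℝ → ℝ → ℝ := fun β e => (1 + Real.exp (β * e))⁻¹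
    let S0 : ℝ → ℝ := fun e => e * (1 - e ^ 2) ^ ((3 : ℝ) / 2) * (ϱ βL e - ϱ βR e)
    let EpS : ℝ := (2 * δ / (nS + 1)) * (cfc S0 hS).trace
    EpS = (2 * δ / (nS + 1)) * ∑ i ∈ Finset.Icc 1 nS, S0 (Real.cos (i * π / (nS + 1))) ∧
    0 < EpS := by
  intro nS δ ϱ S0 EpS
  have hδ : 0 < δ := by simp only [δ]; linarith
  have hnS : (0 : ℝ) < (nS : ℝ) + 1 := by positivity
  have hangle : ∀ k : ℕ, k < nS →
      0 < ((k + 1 : ℕ) : ℝ) * π / (nS + 1) ∧ ((k + 1 : ℕ) : ℝ) * π / (nS + 1) < π := by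
    intro k hk
    refine ⟨by positivity, ?_⟩
    rw [div_lt_iff₀ hnS, mul_comm π]
    gcongr
    exact_mod_cast Nat.succ_lt_succ hk
  have htrace : (cfc S0 hS).trace
      = ∑ k : Fin nS, S0 (Real.cos (((k + 1 : ℕ) : ℝ) * π / (nS + 1))) := by
    refine hH.trace_cfc_eq_sum_of_injective S0
      (fun k => Real.cos (((k + 1 : ℕ) : ℝ) * π / (nS + 1))) ?_
      (fun k j => Real.sin (((j + 1 : ℕ) : ℝ) * (((k + 1 : ℕ) : ℝ) * π / (nS + 1)))) ?_ ?_
    · intro k l hkl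
      have hk := hangle k k.2
      have hl := hangle l l.2
      have h := Real.injOn_cos ⟨hk.1.le, hk.2.le⟩ ⟨hl.1.le, hl.2.le⟩ hkl
      rw [div_left_inj' hnS.ne', mul_left_inj' Real.pi_ne_zero, Nat.cast_inj] at h
      exact Fin.ext (by omega)
    · intro k h
      have hk := hangle k k.2
      have h1 := congrFun h 0
      refine (Real.sin_pos_of_pos_of_lt_pi hk.1 hk.2).ne' ?_
      simpa using h1
    · intro k
      ext i
      have h := sum_neighbours_eq_average nS
        (fun m => Real.sin ((m : ℝ) * (((k + 1 : ℕ) : ℝ) * π / (nS + 1)))) (by simp) (by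
          have : (((nS + 1 : ℕ) : ℝ) * (((k + 1 : ℕ) : ℝ) * π / (nS + 1)))
              = ((k + 1 : ℕ) : ℝ) * π := by
            push_cast
            field_simp
          simp only [this, Real.sin_nat_mul_pi]) i
      simp only [Matrix.mulVec, dotProduct, hdef, Pi.smul_apply, smul_eq_mul]
      refine h.trans ?_
      generalize ((k + 1 : ℕ) : ℝ) * π / (nS + 1) = θ
      have h1 : ((i : ℕ) : ℝ) * θ = ((i + 1 : ℕ) : ℝ) * θ - θ := by push_cast; ring
      have h2 : ((i + 2 : ℕ) : ℝ) * θ = ((i + 1 : ℕ) : ℝ) * θ + θ := by push_cast; ring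
      rw [h1, h2, Real.sin_sub, Real.sin_add]
      ring
  have hpos : ∀ e : ℝ, -1 < e → e < 1 → e ≠ 0 → 0 < S0 e := by
    intro e h1 h2 he
    have hsq : 0 < 1 - e ^ 2 := by nlinarith
    have := mul_pos (Real.rpow_pos_of_pos hsq (3 / 2)) (sub_inv_one_add_exp_mul_pos hlt he)
    simp only [S0, ϱ]
    exact this.trans_eq (by ring)
  have hcos : ∀ k : ℕ, k < nS → Real.cos (((k + 1 : ℕ) : ℝ) * π / (nS + 1)) ≠ 0 →
      0 < S0 (Real.cos (((k + 1 : ℕ) : ℝ) * π / (nS + 1))) := by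
    intro k hk
    obtain ⟨h1, h2⟩ := hangle k hk
    refine hpos _ ?_ ?_
    · rw [← Real.cos_pi]
      exact Real.cos_lt_cos_of_nonneg_of_le_pi h1.le le_rfl h2
    · refine lt_of_lt_of_eq ?_ Real.cos_zero
      exact Real.cos_lt_cos_of_nonneg_of_le_pi le_rfl h2.le h1
  refine ⟨?_, ?_⟩
  · simp only [EpS]
    rw [htrace, Fin.sum_univ_eq_sum_range
      (fun k => S0 (Real.cos (((k + 1 : ℕ) : ℝ) * π / (nS + 1)))) nS,
      Finset.range_eq_Ico, Finset.sum_Ico_add'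
      (fun k : ℕ => S0 (Real.cos ((k : ℝ) * π / (nS + 1)))) 0 nS 1]
    rfl
  · simp only [EpS]
    rw [htrace]
    refine mul_pos (by positivity) (Finset.sum_pos' (fun k _ => ?_) ⟨0, Finset.mem_univ _, ?_⟩)
    · by_cases h : Real.cos (((k + 1 : ℕ) : ℝ) * π / (nS + 1)) = 0
      · rw [h]
        simp [S0]
      · exact (hcos k k.2 h).le
    · refine hcos 0 (Nat.succ_pos _) (Real.cos_pos_of_mem_Ioo ⟨?_, ?_⟩).ne'
      · have := (hangle 0 (Nat.succ_pos _)).1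
        linarith [Real.pi_pos]
      · have : (2 : ℝ) < (nS : ℝ) + 1 := by
          exact_mod_cast (show 2 < 2 * n + 1 + 1 by omega)
        rw [div_lt_div_iff₀ hnS two_pos]
        push_cast
        nlinarith [Real.pi_pos]
end
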